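/- arXiv:1807.11040 — 2 statements merged into one kernel-verified Lean document; each statement's English description precedes it below -/
import Mathlib

section
/- Let p* > 1 and p' > 1 be real numbers, let α' be a real number with 1 < α' < p', and let f : ℝ → ℝ be continuous such that there exists C > 0 with |f(s)| ≤ C|s|^{p*−1} for all |s| ≤ 1, and such that liminf_{|s|→∞} F(s)/|s|^{p*/α'} ≥ L for some L > 0. Then there exists a constant C_L > 0 such that F(s) ≥ (L/2)|s|^{p*/α'} − C_L|s|^{p*/p'} for all s ∈ ℝ. -/
open MeasureTheory Filter

/-- If `p* > 1`, `1 < α' < p'`, `f` is continuous with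
`|f(s)| ≤ C|s|^{p*−1}` for `|s| ≤ 1`, and `liminf_{|s|→∞} F(s)/|s|^{p*/α'} ≥ L > 0`
(with `F(s) = ∫₀^s f`), then there is `C_L > 0` with
`F(s) ≥ (L/2)|s|^{p*/α'} − C_L|s|^{p*/p'}` for all `s`. -/
theorem stmt_8 (pstar p' α' L : ℝ) (f : ℝ → ℝ)
    (hp : 1 < pstar) (hp' : 1 < p') (hα1 : 1 < α') (hα2 : α' < p')
    (hf : Continuous f)
    (h0 : ∃ C : ℝ, 0 < C ∧ ∀ s : ℝ, |s| ≤ 1 → |f s| ≤ C * |s| ^ (pstar - 1))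
    (hL : 0 < L)
    (hliminf : ∀ ε : ℝ, 0 < ε → ∀ᶠ s : ℝ in cocompact ℝ,
      L - ε ≤ (∫ t in (0:ℝ)..s, f t) / |s| ^ (pstar / α')) :
    ∃ C_L : ℝ, 0 < C_L ∧ ∀ s : ℝ,
      (L / 2) * |s| ^ (pstar / α') - C_L * |s| ^ (pstar / p') ≤ ∫ t in (0:ℝ)..s, f t := by
  obtain ⟨C, hC, hfC⟩ := h0
  have ha : 0 < pstar / α' := by positivity
  have hb : 0 < pstar / p' := by positivity
  have hba : pstar / p' ≤ pstar / α' := by gcongr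
  have hbp : pstar / p' ≤ pstar := div_le_self (by linarith) hp'.le
  obtain ⟨K, hK, hKF⟩ := mem_cocompact.mp (hliminf (L / 2) (by linarith))
  have hF : Continuous fun s : ℝ => ∫ t in (0:ℝ)..s, f t :=
    intervalIntegral.continuous_primitive (fun a b => hf.intervalIntegrable a b) 0
  have hg : Continuous fun s : ℝ =>
      (L / 2) * |s| ^ (pstar / α') - ∫ t in (0:ℝ)..s, f t :=
    (continuous_const.mul (continuous_abs.rpow_const fun _ => Or.inr ha.le)).sub hF
  obtain ⟨M, hM⟩ := hK.bddAbove_image hg.continuousOn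
  refine ⟨C + L / 2 + |M|, by positivity, fun s => ?_⟩
  rcases le_total |s| 1 with hs | hs
  · have hint : |∫ t in (0:ℝ)..s, f t| ≤ C * |s| ^ pstar := by
      have hbound := intervalIntegral.norm_integral_le_of_norm_le_const
        (a := 0) (b := s) (f := f) (C := C * |s| ^ (pstar - 1)) (fun t ht => by
          have hts : |t| ≤ |s| := by
            simpa using Set.abs_sub_left_of_mem_uIcc (Set.uIoc_subset_uIcc ht)
          refine (hfC t (hts.trans hs)).trans ?_
          have : 0 ≤ pstar - 1 := by linarith
          gcongr)
      rw [Real.norm_eq_abs, sub_zero, mul_assoc,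
        ← Real.rpow_add_one' (abs_nonneg s) (by linarith), sub_add_cancel] at hbound
      exact hbound
    have hpb : |s| ^ pstar ≤ |s| ^ (pstar / p') :=
      Real.rpow_le_rpow_of_exponent_ge_of_imp (abs_nonneg s) hs hbp (fun _ h => by linarith)
    have hab : |s| ^ (pstar / α') ≤ |s| ^ (pstar / p') :=
      Real.rpow_le_rpow_of_exponent_ge_of_imp (abs_nonneg s) hs hba (fun _ h => by linarith)
    have h1 := mul_le_mul_of_nonneg_left hpb hC.le
    have h2 := mul_le_mul_of_nonneg_left hab (half_pos hL).le
    have h3 : 0 ≤ |M| * |s| ^ (pstar / p') := by positivity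
    linarith [neg_le_of_abs_le hint]
  · have hone : 1 ≤ |s| ^ (pstar / p') := Real.one_le_rpow hs hb.le
    by_cases hsK : s ∈ K
    · have h1 := hM (Set.mem_image_of_mem _ hsK)
      have h2 : |M| ≤ (C + L / 2 + |M|) * |s| ^ (pstar / p') := by
        nlinarith [abs_nonneg M]
      linarith [le_abs_self M]
    · have h1 : L - L / 2 ≤ (∫ t in (0:ℝ)..s, f t) / |s| ^ (pstar / α') := hKF hsK
      rw [le_div_iff₀ (Real.rpow_pos_of_pos (by linarith) _)] at h1
      have h2 : 0 ≤ (C + L / 2 + |M|) * |s| ^ (pstar / p') := by positivity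
      linarith
end

section
/- Let p* > 1 and set q* = p*/(p*−1). Let θ and μ be real numbers with θ > μ > 0, and let f : ℝ → ℝ be continuous such that: (i) there exists s₀ > 0 with s·f(s) ≥ θ·F(s) > 0 for all |s| > s₀ (the Ambrosetti–Rabinowitz condition); (ii) lim_{|s|→∞} f(s)/|s|^{p*−1} = 0. Then there exist a constant C > 0 and s₁ ≥ s₀ such that C·|f(s)|^{q*} ≤ s·f(s) − μ·F(s) for all |s| > s₁. -/
open MeasureTheory Filter

/-- If `|a| ≤ |s| ^ (p - 1)` then `|a| ^ q ≤ |s| * |a|`, where `q = p / (p - 1)` is the exponent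
conjugate to `p`. -/
theorem abs_rpow_conjExponent_le_mul {p a s : ℝ} (hp : 1 < p) (h : |a| ≤ |s| ^ (p - 1)) :
    |a| ^ (p / (p - 1)) ≤ |s| * |a| := by
  have hp' : 0 < p - 1 := sub_pos.mpr hp
  have hq : p / (p - 1) = (p - 1)⁻¹ + 1 := by field_simp; ring
  rw [hq, Real.rpow_add_one' (abs_nonneg a) (by positivity)]
  gcongr
  calc |a| ^ (p - 1)⁻¹ ≤ (|s| ^ (p - 1)) ^ (p - 1)⁻¹ := by gcongr
    _ = |s| := Real.rpow_rpow_inv (abs_nonneg s) hp'.ne'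

/-- If `f s / |s| ^ r` tends to `0` as `|s| → ∞`, then `|f s| ≤ |s| ^ r` for large `|s|`. -/
theorem exists_abs_le_abs_rpow_of_tendsto {f : ℝ → ℝ} {r : ℝ}
    (h : Tendsto (fun s : ℝ => f s / |s| ^ r) (cocompact ℝ) (nhds 0)) :
    ∃ R : ℝ, ∀ s : ℝ, R < |s| → |f s| ≤ |s| ^ r := by
  have hev : ∀ᶠ s in cocompact ℝ, |f s / |s| ^ r| < 1 := by
    filter_upwards [h.eventually (Metric.ball_mem_nhds (0 : ℝ) one_pos)] with s hs
    rwa [dist_zero_right, Real.norm_eq_abs] at hs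
  obtain ⟨R, -, hR⟩ := (Metric.hasBasis_cobounded_compl_closedBall (0 : ℝ)).eventually_iff.mp
    (Metric.cobounded_eq_cocompact (α := ℝ) ▸ hev)
  refine ⟨max R 0, fun s hs => ?_⟩
  have hspos : 0 < |s| ^ r := Real.rpow_pos_of_pos ((le_max_right _ _).trans_lt hs) r
  have hlt : |f s / |s| ^ r| < 1 := hR (by simpa using (le_max_left _ _).trans_lt hs)
  rw [abs_div, abs_of_pos hspos, div_lt_one hspos] at hlt
  exact hlt.le

/-- If `p* > 1`, `q* = p*/(p*−1)`, `θ > μ > 0`, `f` is continuous and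
satisfies the Ambrosetti–Rabinowitz condition `s·f(s) ≥ θ·F(s) > 0` for `|s| > s₀`
(with `F(s) = ∫₀^s f`) together with `f(s)/|s|^{p*−1} → 0` as `|s| → ∞`, then there
are `C > 0` and `s₁ ≥ s₀` with `C·|f(s)|^{q*} ≤ s·f(s) − μ·F(s)` for `|s| > s₁`. -/
theorem stmt_9 (pstar qstar θ μ s₀ : ℝ) (f : ℝ → ℝ)
    (hp : 1 < pstar) (hq : qstar = pstar / (pstar - 1))
    (hμ : 0 < μ) (hθμ : μ < θ)
    (hf : Continuous f) (hs₀ : 0 < s₀)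
    (hAR : ∀ s : ℝ, s₀ < |s| →
      0 < θ * (∫ t in (0:ℝ)..s, f t) ∧
      θ * (∫ t in (0:ℝ)..s, f t) ≤ s * f s)
    (hlim : Tendsto (fun s : ℝ => f s / |s| ^ (pstar - 1)) (cocompact ℝ) (nhds 0)) :
    ∃ C : ℝ, 0 < C ∧ ∃ s₁ : ℝ, s₀ ≤ s₁ ∧ ∀ s : ℝ, s₁ < |s| →
      C * |f s| ^ qstar ≤ s * f s - μ * ∫ t in (0:ℝ)..s, f t := by
  obtain ⟨R, hR⟩ := exists_abs_le_abs_rpow_of_tendsto hlim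
  have hθ : 0 < θ := hμ.trans hθμ
  refine ⟨1 - μ / θ, sub_pos.mpr ((div_lt_one hθ).mpr hθμ), max s₀ R, le_max_left _ _,
    fun s hs => ?_⟩
  obtain ⟨hpos, hle⟩ := hAR s ((le_max_left _ _).trans_lt hs)
  have hpow : |f s| ^ qstar ≤ s * f s := by
    rw [hq, ← abs_of_pos (hpos.trans_le hle), abs_mul]
    exact abs_rpow_conjExponent_le_mul hp (hR s ((le_max_right _ _).trans_lt hs))
  have hC : 0 ≤ 1 - μ / θ := sub_nonneg.mpr ((div_le_one hθ).mpr hθμ.le)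
  calc (1 - μ / θ) * |f s| ^ qstar ≤ (1 - μ / θ) * (s * f s) := by gcongr
    _ = s * f s - μ / θ * (s * f s) := by ring
    _ ≤ s * f s - μ / θ * (θ * ∫ t in (0:ℝ)..s, f t) := by gcongr
    _ = s * f s - μ * ∫ t in (0:ℝ)..s, f t := by field_simp
end
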